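/- Let q be a prime power with q ≡ 1 (mod 4), set t = (q−1)/4, let T be a generator of the group of multiplicative characters of F_q^×, and let λ ∈ F_q^×. Define S₂ := (3/(q−1))·Σ_{j=0}^{q−2} (g(T^j)²·g(T^{2t+j})² / g(T^{4j}))·T^{4j}(4λ). Then S₂ = −6q + 3q² · binom(T^{3t}, T^t) · ₂F₁(T^{3t}, T^t; T^{2t} | 1/λ⁴)_q. -/

import Mathlib

/-- The standard additive character of a finite field `F` of characteristic `p`,
built from a primitive `p`-th root of unity `ζ` in `ℂ`:  `θ x = ζ ^ tr(x)`. -/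
noncomputable def stdAddChar {F : Type*} [Field F] [Fintype F] (p : ℕ) [CharP F p]
    [Algebra (ZMod p) F] (ζ : ℂ) (x : F) : ℂ :=
  ζ ^ (Algebra.trace (ZMod p) F x).val

/-- The Gauss sum `g(χ) = ∑ₓ χ(x) θ(x)` with respect to the standard additive character. -/
noncomputable def gaussSum' {F : Type*} [Field F] [Fintype F] (p : ℕ) [CharP F p]
    [Algebra (ZMod p) F] (ζ : ℂ) (χ : MulChar F ℂ) : ℂ :=
  ∑ x : F, χ x * stdAddChar p ζ x

/-- Greene's normalized Jacobi sum `binom(A,B) = B(-1)/q · ∑ₓ A(x) B̄(1-x)`. -/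
noncomputable def jacB {F : Type*} [Field F] [Fintype F] (A B : MulChar F ℂ) : ℂ :=
  B (-1) / (Fintype.card F : ℂ) * ∑ x : F, A x * B⁻¹ (1 - x)

/-- Greene's finite field hypergeometric function `₂F₁(A, B; C | x)`. -/
noncomputable def greene2F1 {F : Type*} [Field F] [Fintype F]
    (A B C : MulChar F ℂ) (x : F) : ℂ :=
  (Fintype.card F : ℂ) / ((Fintype.card F : ℂ) - 1) *
    ∑ᶠ χ : MulChar F ℂ, jacB (A * χ) χ * jacB (B * χ) (C * χ) * χ x

/-- Greene's finite field hypergeometric function `₃F₂(A₀, A₁, A₂; B₁, B₂ | x)`. -/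
noncomputable def greene3F2 {F : Type*} [Field F] [Fintype F]
    (A₀ A₁ A₂ B₁ B₂ : MulChar F ℂ) (x : F) : ℂ :=
  (Fintype.card F : ℂ) / ((Fintype.card F : ℂ) - 1) *
    ∑ᶠ χ : MulChar F ℂ,
      jacB (A₀ * χ) χ * jacB (A₁ * χ) (B₁ * χ) * jacB (A₂ * χ) (B₂ * χ) * χ x

section Lemmas

open Finset

section QuadraticCharacter

variable {F : Type*} [Field F] [Fintype F]

lemma MulChar.eq_ringHomComp_quadraticChar [DecidableEq F] {φ : MulChar F ℂ}
    (hφ : φ ≠ 1) (hφ2 : φ ^ 2 = 1) :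
    φ = (quadraticChar F).ringHomComp (Int.castRingHom ℂ) := by
  have hsq : ∀ a : F, a ≠ 0 → φ a ^ 2 = 1 := fun a ha ↦ by
    rw [← MulChar.pow_apply' φ two_ne_zero, hφ2, MulChar.one_apply ha.isUnit]
  have hsquare : ∀ a : F, a ≠ 0 → IsSquare a → φ a = 1 := by
    rintro _ ha ⟨b, rfl⟩
    rw [map_mul, ← sq, hsq b (left_ne_zero_of_mul ha)]
  obtain ⟨b, hb⟩ := MulChar.ne_one_iff.1 hφ
  have hb0 : (b : F) ≠ 0 := b.ne_zero
  have hb1 : φ b = -1 :=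
    (sq_eq_sq_iff_eq_or_eq_neg.1 ((hsq b hb0).trans (one_pow 2).symm)).resolve_left hb
  have hbq : quadraticChar F b = -1 :=
    (quadraticChar_dichotomy hb0).resolve_left fun h ↦
      hb (hsquare b hb0 ((quadraticChar_one_iff_isSquare hb0).1 h))
  ext a
  rw [MulChar.ringHomComp_apply]
  have ha : (a : F) ≠ 0 := a.ne_zero
  rcases quadraticChar_dichotomy ha with h | h
  · rw [h, hsquare a ha ((quadraticChar_one_iff_isSquare ha).1 h)]
    simp
  · have hab : quadraticChar F (a * b) = 1 := by rw [map_mul, h, hbq]; norm_num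
    have := hsquare _ (mul_ne_zero ha hb0)
      ((quadraticChar_one_iff_isSquare (mul_ne_zero ha hb0)).1 hab)
    rw [map_mul, hb1] at this
    rw [h]
    simp only [map_neg, map_one]
    linear_combination -this

lemma MulChar.eq_of_sq_eq_one {φ χ : MulChar F ℂ} (hφ : φ ≠ 1) (hφ2 : φ ^ 2 = 1)
    (hχ : χ ≠ 1) (hχ2 : χ ^ 2 = 1) : χ = φ := by
  classical
  rw [eq_ringHomComp_quadraticChar hφ hφ2, eq_ringHomComp_quadraticChar hχ hχ2]

lemma MulChar.card_sqrts_eq {φ : MulChar F ℂ} [DecidableEq F] (hF : ringChar F ≠ 2)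
    (hφ : φ ≠ 1) (hφ2 : φ ^ 2 = 1) (u : F) : (#{y : F | y ^ 2 = u} : ℂ) = φ u + 1 := by
  have h := quadraticChar_card_sqrts hF u
  rw [eq_ringHomComp_quadraticChar hφ hφ2, MulChar.ringHomComp_apply]
  have h2 : {x : F | x ^ 2 = u}.toFinset = ({y : F | y ^ 2 = u} : Finset F) := by
    ext; simp
  rw [h2] at h
  simpa using congrArg (Int.cast : ℤ → ℂ) h

lemma apply_four_mul_jacobiSum_self {χ φ : MulChar F ℂ} (hF : ringChar F ≠ 2)
    (hφ : φ ≠ 1) (hφ2 : φ ^ 2 = 1) (hχ : χ ≠ 1) :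
    χ 4 * jacobiSum χ χ = jacobiSum χ φ := by
  classical
  have h2 : (2 : F) ≠ 0 := Ring.two_ne_zero hF
  calc χ 4 * jacobiSum χ χ = ∑ x : F, χ (1 - (1 - 2 * x) ^ 2) := by
        rw [jacobiSum, mul_sum]
        refine sum_congr rfl fun x _ ↦ ?_
        rw [← map_mul, ← map_mul]
        congr 1
        ring
    _ = ∑ y : F, χ (1 - y ^ 2) :=
        ((Equiv.mulLeft₀ (2 : F) h2).trans (Equiv.subLeft 1)).sum_comp fun y ↦ χ (1 - y ^ 2)
    _ = ∑ u : F, (φ u + 1) * χ (1 - u) := by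
        rw [← sum_fiberwise univ (fun y : F ↦ y ^ 2)]
        refine sum_congr rfl fun u _ ↦ ?_
        rw [← MulChar.card_sqrts_eq hF hφ hφ2, ← nsmul_eq_mul, ← sum_const]
        refine sum_congr rfl fun y hy ↦ ?_
        rw [(mem_filter.1 hy).2]
    _ = jacobiSum χ φ := by
        simp only [add_mul, one_mul, sum_add_distrib]
        rw [show ∑ x : F, χ (1 - x) = ∑ x, χ x from (Equiv.subLeft 1).sum_comp χ,
          MulChar.sum_eq_zero_of_ne_one hχ, add_zero,
          jacobiSum_comm, jacobiSum]

end QuadraticCharacter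

section GaussSum

variable {F : Type*} [Field F] [Fintype F] {ψ : AddChar F ℂ}

lemma gaussSum_ne_zero_of_isPrimitive (hψ : ψ.IsPrimitive) (χ : MulChar F ℂ) :
    gaussSum χ ψ ≠ 0 := by
  rcases eq_or_ne χ 1 with rfl | hχ
  · rw [gaussSum_one_left]
    · norm_num
    · simpa using hψ one_ne_zero
  · exact gaussSum_ne_zero_of_nontrivial (by simp) hχ hψ

/-- The quadratic case of the Hasse–Davenport product formula. -/
lemma gaussSum_mul_gaussSum_quadratic {χ φ : MulChar F ℂ} (hF : ringChar F ≠ 2)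
    (hφ : φ ≠ 1) (hφ2 : φ ^ 2 = 1) (hψ : ψ.IsPrimitive) :
    χ 4 * (gaussSum χ ψ * gaussSum (φ * χ) ψ) = gaussSum (χ ^ 2) ψ * gaussSum φ ψ := by
  have h2 : (2 : F) ≠ 0 := Ring.two_ne_zero hF
  have h4 : (4 : F) = 2 ^ 2 := by norm_num
  by_cases hχ : χ = 1
  · rw [hχ, MulChar.one_apply (h4 ▸ (pow_ne_zero 2 h2).isUnit)]
    simp
  by_cases hχ2 : χ ^ 2 = 1
  · rw [MulChar.eq_of_sq_eq_one hφ hφ2 hχ hχ2, ← sq, hφ2, h4, map_pow,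
      ← MulChar.pow_apply' φ two_ne_zero, hφ2, MulChar.one_apply h2.isUnit]
    ring
  have hχφ : χ * φ ≠ 1 := fun h ↦ hχ2 <| by
    rw [eq_inv_of_mul_eq_one_left h, inv_pow, hφ2, inv_one]
  have e1 := jacobiSum_mul_nontrivial (sq χ ▸ hχ2) ψ
  have e2 := jacobiSum_mul_nontrivial hχφ ψ
  have e3 := apply_four_mul_jacobiSum_self hF hφ hφ2 hχ
  rw [← sq] at e1
  apply mul_left_cancel₀ (gaussSum_ne_zero_of_isPrimitive hψ χ)
  rw [mul_comm φ χ]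
  linear_combination (-χ 4 * gaussSum (χ * φ) ψ) * e1 + gaussSum (χ ^ 2) ψ * e2 +
    gaussSum (χ ^ 2) ψ * gaussSum (χ * φ) ψ * e3

lemma gaussSum_mul_gaussSum_inv {χ : MulChar F ℂ} (hχ : χ ≠ 1) (hψ : ψ.IsPrimitive) :
    gaussSum χ ψ * gaussSum χ⁻¹ ψ = χ (-1) * Fintype.card F := by
  rw [← mul_gaussSum_inv_eq_gaussSum χ⁻¹, mul_left_comm, gaussSum_mul_gaussSum_eq_card hχ hψ,
    MulChar.inv_apply', inv_neg_one]

lemma gaussSum_mul_gaussSum_eq_jacobiSum [DecidableEq (MulChar F ℂ)] {χ φ : MulChar F ℂ}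
    (hφ : φ ≠ 1) (hφ2 : φ ^ 2 = 1) (hφn : φ (-1) = 1) (hψ : ψ.IsPrimitive) :
    gaussSum χ ψ * gaussSum φ ψ =
      gaussSum (φ * χ) ψ * (jacobiSum χ φ - if χ = φ then (Fintype.card F : ℂ) - 1 else 0) := by
  have hinv : φ⁻¹ = φ := inv_eq_of_mul_eq_one_left (by rw [← sq, hφ2])
  split_ifs with h
  · have e := gaussSum_mul_gaussSum_inv hφ hψ
    have e' := jacobiSum_nontrivial_inv hφ
    rw [hinv, hφn] at e e'
    rw [h, e, e', ← sq, hφ2, gaussSum_one_left (by simpa using hψ one_ne_zero)]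
    ring
  · rw [sub_zero, mul_comm φ χ, jacobiSum_mul_nontrivial]
    exact fun h' ↦ h (by rw [eq_inv_of_mul_eq_one_left h', hinv])

lemma gaussSum_quotient_eq_jacobiSum [DecidableEq (MulChar F ℂ)] {χ φ : MulChar F ℂ}
    (hF : ringChar F ≠ 2) (hφ : φ ≠ 1) (hφ2 : φ ^ 2 = 1) (hφn : φ (-1) = 1)
    (hψ : ψ.IsPrimitive) :
    gaussSum χ ψ ^ 2 * gaussSum (φ * χ) ψ ^ 2 / gaussSum (χ ^ 4) ψ * χ 4 ^ 4 =
      Fintype.card F *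
        (jacobiSum (χ ^ 2) φ - if χ ^ 2 = φ then (Fintype.card F : ℂ) - 1 else 0) := by
  have hinv : φ⁻¹ = φ := inv_eq_of_mul_eq_one_left (by rw [← sq, hφ2])
  have e := gaussSum_mul_gaussSum_inv hφ hψ
  rw [hinv, hφn, one_mul] at e
  have e1 := gaussSum_mul_gaussSum_quadratic (χ := χ) hF hφ hφ2 hψ
  have e2 := gaussSum_mul_gaussSum_quadratic (χ := χ ^ 2) hF hφ hφ2 hψ
  have e3 := gaussSum_mul_gaussSum_eq_jacobiSum (χ := χ ^ 2) hφ hφ2 hφn hψ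
  rw [← pow_mul, MulChar.pow_apply' χ two_ne_zero] at e2
  set J := jacobiSum (χ ^ 2) φ - if χ ^ 2 = φ then (Fintype.card F : ℂ) - 1 else 0
  rw [← e]
  have h4 := gaussSum_ne_zero_of_isPrimitive hψ (χ ^ 4)
  have hpc := gaussSum_ne_zero_of_isPrimitive hψ (φ * χ ^ 2)
  rw [div_mul_eq_mul_div, div_eq_iff h4]
  apply mul_left_cancel₀ hpc
  norm_num at e2
  calc _ = (χ 4 * (gaussSum χ ψ * gaussSum (φ * χ) ψ)) ^ 2 * χ 4 ^ 2 *
        gaussSum (φ * χ ^ 2) ψ := by ring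
    _ = gaussSum φ ψ ^ 2 * gaussSum (χ ^ 2) ψ *
        (χ 4 ^ 2 * (gaussSum (χ ^ 2) ψ * gaussSum (φ * χ ^ 2) ψ)) := by rw [e1]; ring
    _ = gaussSum φ ψ ^ 2 * (gaussSum (χ ^ 2) ψ * gaussSum φ ψ) * gaussSum (χ ^ 4) ψ := by
      rw [e2]; ring
    _ = _ := by rw [e3]; ring

end GaussSum

section QuarticCharacter

lemma MulChar.quartic_apply_neg_four {F : Type*} [Field F] {ω : MulChar F ℂ}
    (hF : ringChar F ≠ 2) (hsq : IsSquare (-1 : F)) (hω4 : ω ^ 4 = 1) :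
    ω (-1) * ω 4 = 1 := by
  obtain ⟨i, hi⟩ := hsq
  have h4 : (4 : F) ≠ 0 := by
    rw [show (4 : F) = 2 ^ 2 by norm_num]
    exact pow_ne_zero 2 (Ring.two_ne_zero hF)
  have e : (-1 : F) * 4 = (1 + i) ^ 4 := by linear_combination (i ^ 2 + 4 * i + 5) * hi
  have hi0 : 1 + i ≠ 0 := fun h ↦ by
    rw [h, zero_pow four_ne_zero] at e
    exact h4 (by linear_combination -e)
  rw [← map_mul, e, map_pow, ← MulChar.pow_apply' ω four_ne_zero, hω4,
    MulChar.one_apply hi0.isUnit]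

variable {F : Type*} [Field F] [Fintype F] {ψ : AddChar F ℂ} {ω : MulChar F ℂ}

lemma jacobiSum_triple_product {χ : MulChar F ℂ} (hF : ringChar F ≠ 2)
    (hsq : IsSquare (-1 : F)) (hω2 : ω ^ 2 ≠ 1) (hω4 : ω ^ 4 = 1) (hψ : ψ.IsPrimitive) :
    ω (-1) * (jacobiSum ω⁻¹ ω⁻¹ * jacobiSum (ω⁻¹ * χ⁻¹) χ *
      jacobiSum (ω * χ⁻¹) (ω ^ 2 * χ⁻¹)⁻¹) =
      Fintype.card F * jacobiSum (χ ^ 2) (ω ^ 2) := by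
  classical
  have h4 : (4 : F) ≠ 0 := by
    rw [show (4 : F) = 2 ^ 2 by norm_num]
    exact pow_ne_zero 2 (Ring.two_ne_zero hF)
  have hφ2 : (ω ^ 2) ^ 2 = 1 := by rw [← pow_mul, hω4]
  have hinv : (ω ^ 2)⁻¹ = ω ^ 2 := inv_eq_of_mul_eq_one_left (by rw [← sq, hφ2])
  have hω : ω⁻¹ ≠ 1 := fun h ↦ hω2 (by rw [inv_eq_one.1 h, one_pow])
  have hω3 : ω ^ 2 * ω = ω⁻¹ := eq_inv_of_mul_eq_one_left (by rw [← pow_succ, ← pow_succ, hω4])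
  have hω3' : ω ^ 2 * ω⁻¹ = ω := by rw [sq, mul_assoc, mul_inv_cancel, mul_one]
  have hφn : (ω ^ 2) (-1) = 1 := by
    rw [MulChar.pow_apply' _ two_ne_zero, ← map_pow, neg_one_sq, map_one]
  have hω4' : ω⁻¹ 4 = ω (-1) := by
    rw [MulChar.inv_apply_eq_inv']
    exact inv_eq_of_mul_eq_one_left (MulChar.quartic_apply_neg_four hF hsq hω4)
  have hχ4 : χ⁻¹ 4 * χ 4 = 1 := by
    rw [← MulChar.mul_apply, inv_mul_cancel, MulChar.one_apply h4.isUnit]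
  have n1 : ω⁻¹ * ω⁻¹ = ω ^ 2 := by rw [← hinv, sq, mul_inv]
  have n2 : ω⁻¹ * χ⁻¹ * χ = ω⁻¹ := by rw [mul_assoc, inv_mul_cancel, mul_one]
  have n3 : (ω ^ 2 * χ⁻¹)⁻¹ = ω ^ 2 * χ := by rw [mul_inv, inv_inv, hinv]
  have n4 : ω * χ⁻¹ * (ω ^ 2 * χ) = ω⁻¹ := by
    rw [← hω3, mul_mul_mul_comm, inv_mul_cancel, mul_one, mul_comm]
  have n5 : ω ^ 2 * (ω⁻¹ * χ⁻¹) = ω * χ⁻¹ := by rw [← mul_assoc, hω3']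
  have n6 : (ω⁻¹ * χ⁻¹) ^ 2 = (ω ^ 2 * χ ^ 2)⁻¹ := by rw [mul_pow, inv_pow, inv_pow, mul_inv]
  have j1 := jacobiSum_mul_nontrivial (χ := ω⁻¹) (φ := ω⁻¹) (n1 ▸ hω2) ψ
  have j2 := jacobiSum_mul_nontrivial (χ := ω⁻¹ * χ⁻¹) (φ := χ) (n2.symm ▸ hω) ψ
  have j3 := jacobiSum_mul_nontrivial (χ := ω * χ⁻¹) (φ := ω ^ 2 * χ) (n4.symm ▸ hω) ψ
  have d1 := gaussSum_mul_gaussSum_quadratic (χ := χ) hF hω2 hφ2 hψ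
  have d2 := gaussSum_mul_gaussSum_quadratic (χ := ω⁻¹ * χ⁻¹) hF hω2 hφ2 hψ
  have g1 := gaussSum_mul_gaussSum_eq_jacobiSum (χ := χ ^ 2) hω2 hφ2 hφn hψ
  rw [n1] at j1
  rw [n2] at j2
  rw [n4] at j3
  rw [n5, n6, MulChar.mul_apply, hω4'] at d2
  rw [n3]
  have h1 := gaussSum_ne_zero_of_isPrimitive hψ ω⁻¹
  have hp := gaussSum_ne_zero_of_isPrimitive hψ (ω ^ 2)
  have key : ω (-1) * (jacobiSum ω⁻¹ ω⁻¹ * jacobiSum (ω⁻¹ * χ⁻¹) χ *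
      jacobiSum (ω * χ⁻¹) (ω ^ 2 * χ)) =
      gaussSum (χ ^ 2) ψ * gaussSum (ω ^ 2) ψ * gaussSum (ω ^ 2 * χ ^ 2)⁻¹ ψ := by
    apply mul_left_cancel₀ (mul_ne_zero (mul_ne_zero h1 h1) hp)
    calc _ = ω (-1) * (gaussSum (ω ^ 2) ψ * jacobiSum ω⁻¹ ω⁻¹) *
          (gaussSum ω⁻¹ ψ * jacobiSum (ω⁻¹ * χ⁻¹) χ) *
          (gaussSum ω⁻¹ ψ * jacobiSum (ω * χ⁻¹) (ω ^ 2 * χ)) * 1 := by ring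
      _ = gaussSum ω⁻¹ ψ ^ 2 *
          (ω (-1) * χ⁻¹ 4 * (gaussSum (ω⁻¹ * χ⁻¹) ψ * gaussSum (ω * χ⁻¹) ψ)) *
          (χ 4 * (gaussSum χ ψ * gaussSum (ω ^ 2 * χ) ψ)) := by rw [j1, j2, j3, ← hχ4]; ring
      _ = _ := by rw [d1, d2]; ring
  rw [key, g1]
  by_cases hc : ω ^ 2 * χ ^ 2 = 1
  · have hcχ : χ ^ 2 = ω ^ 2 := by rw [eq_inv_of_mul_eq_one_right hc, hinv]
    have e := jacobiSum_nontrivial_inv hω2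
    rw [hinv, hφn] at e
    rw [hc, inv_one, if_pos hcχ, gaussSum_one_left (by simpa using hψ one_ne_zero), hcχ, e]
    ring
  · have hcχ : χ ^ 2 ≠ ω ^ 2 := fun h ↦ hc (by rw [h, ← sq, hφ2])
    have e := gaussSum_mul_gaussSum_inv hc hψ
    rw [MulChar.mul_apply, hφn, one_mul, MulChar.pow_apply' _ two_ne_zero, ← map_pow,
      neg_one_sq, map_one, one_mul] at e
    rw [if_neg hcχ, sub_zero, mul_right_comm, e]

lemma MulChar.filter_sq_eq_sq [Fintype (MulChar F ℂ)] [DecidableEq (MulChar F ℂ)]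
    (hω2 : ω ^ 2 ≠ 1) (hω4 : ω ^ 4 = 1) :
    ({χ | χ ^ 2 = ω ^ 2} : Finset (MulChar F ℂ)) = {ω, ω⁻¹} := by
  have hφ2 : (ω ^ 2) ^ 2 = 1 := by rw [← pow_mul, hω4]
  ext χ
  simp only [mem_filter, mem_univ, true_and, mem_insert, mem_singleton]
  constructor
  · intro h
    have h1 : (χ * ω⁻¹) ^ 2 = 1 := by rw [mul_pow, h, ← mul_pow, mul_inv_cancel, one_pow]
    by_cases h2 : χ * ω⁻¹ = 1
    · exact Or.inl (mul_inv_eq_one.1 h2)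
    · right
      rw [mul_inv_eq_iff_eq_mul.1 (MulChar.eq_of_sq_eq_one hω2 hφ2 h2 h1)]
      exact eq_inv_of_mul_eq_one_left (by rw [← pow_succ, ← pow_succ, hω4])
  · rintro (rfl | rfl)
    · rfl
    · rw [inv_pow]
      exact inv_eq_of_mul_eq_one_left (by rw [← sq, hφ2])

end QuarticCharacter

section GreeneFunction

variable {F : Type*} [Field F] [Fintype F]

lemma jacB_eq_jacobiSum (A B : MulChar F ℂ) :
    jacB A B = B (-1) / Fintype.card F * jacobiSum A B⁻¹ := rfl

lemma jacB_triple_product {ψ : AddChar F ℂ} {ω χ : MulChar F ℂ} (hF : ringChar F ≠ 2)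
    (hsq : IsSquare (-1 : F)) (hω2 : ω ^ 2 ≠ 1) (hω4 : ω ^ 4 = 1) (hψ : ψ.IsPrimitive) :
    (Fintype.card F : ℂ) ^ 2 * (jacB ω⁻¹ ω * (jacB (ω⁻¹ * χ⁻¹) χ⁻¹ *
      jacB (ω * χ⁻¹) (ω ^ 2 * χ⁻¹))) = jacobiSum (χ ^ 2) (ω ^ 2) := by
  have hq : (Fintype.card F : ℂ) ≠ 0 := by simp
  have hsgn : ∀ η : MulChar F ℂ, η (-1) ^ 2 = 1 := fun η ↦ by
    rw [← map_pow, neg_one_sq, map_one]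
  have h := jacobiSum_triple_product (χ := χ) hF hsq hω2 hω4 hψ
  apply mul_left_cancel₀ hq
  rw [← h]
  simp only [jacB_eq_jacobiSum, inv_inv, MulChar.mul_apply, MulChar.pow_apply' ω two_ne_zero,
    hsgn]
  field_simp
  linear_combination (ω (-1) * jacobiSum ω⁻¹ ω⁻¹ * jacobiSum (ω⁻¹ * χ⁻¹) χ *
    jacobiSum (ω * χ⁻¹) (ω ^ 2 * χ⁻¹)⁻¹) * hsgn χ⁻¹

lemma sum_gaussSum_quotient_eq_greene2F1 [Fintype (MulChar F ℂ)] {ψ : AddChar F ℂ}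
    {ω : MulChar F ℂ} (hF : ringChar F ≠ 2) (hsq : IsSquare (-1 : F)) (hω2 : ω ^ 2 ≠ 1)
    (hω4 : ω ^ 4 = 1) (hψ : ψ.IsPrimitive) {l : F} (hl : l ≠ 0) :
    ∑ χ : MulChar F ℂ, gaussSum χ ψ ^ 2 * gaussSum (ω ^ 2 * χ) ψ ^ 2 / gaussSum (χ ^ 4) ψ *
        (χ ^ 4) (4 * l) =
      ((Fintype.card F : ℂ) - 1) * (-2 * Fintype.card F + (Fintype.card F : ℂ) ^ 2 *
        jacB ω⁻¹ ω * greene2F1 ω⁻¹ ω (ω ^ 2) (l ^ 4)⁻¹) := by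
  classical
  have hq1 : (Fintype.card F : ℂ) - 1 ≠ 0 := by
    rw [sub_ne_zero]
    exact_mod_cast Fintype.one_lt_card.ne'
  have hφ2 : (ω ^ 2) ^ 2 = 1 := by rw [← pow_mul, hω4]
  have hφn : (ω ^ 2) (-1) = 1 := by
    rw [MulChar.pow_apply' _ two_ne_zero, ← map_pow, neg_one_sq, map_one]
  have hne : ω ≠ ω⁻¹ := fun h ↦ hω2 (by rw [sq]; exact mul_eq_one_iff_eq_inv.2 h)
  have hl4 : ∀ χ : MulChar F ℂ, χ ^ 4 = 1 → χ l ^ 4 = 1 := fun χ hχ ↦ by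
    rw [← MulChar.pow_apply' χ four_ne_zero, hχ, MulChar.one_apply hl.isUnit]
  have hcorr : ∑ χ : MulChar F ℂ,
      (if χ ^ 2 = ω ^ 2 then (Fintype.card F : ℂ) - 1 else 0) * χ l ^ 4 =
      2 * ((Fintype.card F : ℂ) - 1) := by
    simp only [ite_mul, zero_mul]
    rw [← sum_filter, MulChar.filter_sq_eq_sq hω2 hω4, sum_pair hne, hl4 ω hω4,
      hl4 ω⁻¹ (by rw [inv_pow, hω4, inv_one])]
    ring
  have hgreene : (Fintype.card F : ℂ) ^ 2 * jacB ω⁻¹ ω * (((Fintype.card F : ℂ) - 1) *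
      greene2F1 ω⁻¹ ω (ω ^ 2) (l ^ 4)⁻¹) =
      Fintype.card F * ∑ χ : MulChar F ℂ, jacobiSum (χ ^ 2) (ω ^ 2) * χ l ^ 4 := by
    rw [greene2F1, finsum_eq_sum_of_fintype, ← mul_assoc (_ - 1), mul_div_cancel₀ _ hq1,
      ← Equiv.sum_comp (Equiv.inv (MulChar F ℂ)), mul_left_comm, mul_sum]
    congr 1
    refine sum_congr rfl fun χ _ ↦ ?_
    rw [Equiv.inv_apply, ← jacB_triple_product (χ := χ) hF hsq hω2 hω4 hψ,
      MulChar.inv_apply', inv_inv, map_pow]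
    ring
  have hterm : ∀ χ : MulChar F ℂ, gaussSum χ ψ ^ 2 * gaussSum (ω ^ 2 * χ) ψ ^ 2 /
      gaussSum (χ ^ 4) ψ * (χ ^ 4) (4 * l) = Fintype.card F *
        (jacobiSum (χ ^ 2) (ω ^ 2) * χ l ^ 4 -
          (if χ ^ 2 = ω ^ 2 then (Fintype.card F : ℂ) - 1 else 0) * χ l ^ 4) := fun χ ↦ by
    rw [MulChar.pow_apply' χ four_ne_zero, map_mul, mul_pow, ← mul_assoc,
      gaussSum_quotient_eq_jacobiSum hF hω2 hφ2 hφn hψ]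
    ring
  simp only [hterm]
  rw [← mul_sum, sum_sub_distrib, hcorr]
  linear_combination -hgreene

end GreeneFunction

section StandardCharacter

variable {F : Type*} [Field F] [Fintype F] {p : ℕ} [Fact p.Prime] [CharP F p]
  [Algebra (ZMod p) F] {ζ : ℂ}

lemma exists_isPrimitive_gaussSum'_eq (hζ : IsPrimitiveRoot ζ p) :
    ∃ ψ : AddChar F ℂ, ψ.IsPrimitive ∧ ∀ χ, gaussSum' p ζ χ = gaussSum χ ψ := by
  let ψ : AddChar F ℂ := (AddChar.zmodChar p hζ.pow_eq_one).compAddMonoidHom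
    (Algebra.trace (ZMod p) F).toAddMonoidHom
  refine ⟨ψ, AddChar.IsPrimitive.of_ne_one (AddChar.ne_one_iff.2 ?_), fun χ ↦ rfl⟩
  obtain ⟨a, ha⟩ := Algebra.trace_surjective (ZMod p) F 1
  refine ⟨a, ?_⟩
  change ζ ^ (Algebra.trace (ZMod p) F a).val ≠ 1
  rw [ha, ZMod.val_one, pow_one]
  exact hζ.ne_one (Fact.out : p.Prime).one_lt

end StandardCharacter

end Lemmas

/-- Proposition 4.6: for `q ≡ 1 (mod 4)`, `t = (q-1)/4`, `T` a generator of the character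
group of `F_q^×`, and `λ ∈ F_q^×`:
`S₂ = (3/(q-1))·∑_{j=0}^{q-2} (g(T^j)²·g(T^{2t+j})²/g(T^{4j}))·T^{4j}(4λ)
    = -6q + 3q²·binom(T^{3t}, T^t)·₂F₁(T^{3t}, T^t; T^{2t} | 1/λ⁴)`. -/
theorem S0022_eq
    (F : Type*) [Field F] [Fintype F] (p : ℕ) [Fact p.Prime] [CharP F p] [Algebra (ZMod p) F]
    (ζ : ℂ) (hζ : IsPrimitiveRoot ζ p)
    (q t : ℕ) (hq : q = Fintype.card F) (hq4 : q % 4 = 1) (ht : t = (q - 1) / 4)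
    (T : MulChar F ℂ) (hT : ∀ χ : MulChar F ℂ, χ ∈ Subgroup.zpowers T)
    (lam : F) (hlam : lam ≠ 0) :
    (3 / ((q : ℂ) - 1)) *
        ∑ j ∈ Finset.range (q - 1),
          gaussSum' p ζ (T ^ j) ^ 2 * gaussSum' p ζ (T ^ (2 * t + j)) ^ 2 /
              gaussSum' p ζ (T ^ (4 * j)) * (T ^ (4 * j)) (4 * lam) =
      -6 * (q : ℂ) + 3 * (q : ℂ) ^ 2 * jacB (T ^ (3 * t)) (T ^ t) *
        greene2F1 (T ^ (3 * t)) (T ^ t) (T ^ (2 * t)) (lam ^ 4)⁻¹ := by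
  classical
  have : Fintype (MulChar F ℂ) := Fintype.ofFinite _
  have hq1 : 1 < Fintype.card F := Fintype.one_lt_card
  have hF : ringChar F ≠ 2 := fun h ↦ by
    have := FiniteField.even_card_of_char_two h
    omega
  have hsq : IsSquare (-1 : F) := FiniteField.isSquare_neg_one_iff.2 (by omega)
  have hord : orderOf T = q - 1 := by
    rw [orderOf_eq_card_of_forall_mem_zpowers hT,
      MulChar.card_eq_card_units_of_hasEnoughRootsOfUnity, Nat.card_eq_fintype_card,
      Fintype.card_units, hq]
  have h4t : q - 1 = 4 * t := by omega
  have hω4 : (T ^ t) ^ 4 = 1 := by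
    rw [← pow_mul, mul_comm, ← h4t, ← hord, pow_orderOf_eq_one]
  have hω2 : (T ^ t) ^ 2 ≠ 1 := by
    rw [← pow_mul]
    exact pow_ne_one_of_lt_orderOf (by omega) (by omega)
  have hT3 : T ^ (3 * t) = (T ^ t)⁻¹ :=
    eq_inv_of_mul_eq_one_left (by rw [← hω4, ← pow_add, ← pow_mul]; congr 1; ring)
  have hT2 : T ^ (2 * t) = (T ^ t) ^ 2 := by rw [← pow_mul, mul_comm]
  obtain ⟨ψ, hψ, hg⟩ := exists_isPrimitive_gaussSum'_eq (F := F) hζ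
  have hqc : (q : ℂ) - 1 ≠ 0 := by
    rw [sub_ne_zero]
    exact_mod_cast (hq ▸ hq1).ne'
  have hsum := sum_gaussSum_quotient_eq_greene2F1 hF hsq hω2 hω4 hψ hlam
  rw [← IsCyclic.image_range_orderOf hT, Finset.sum_image, hord, ← hq] at hsum
  · have hsum' : ∑ j ∈ Finset.range (q - 1), gaussSum' p ζ (T ^ j) ^ 2 *
        gaussSum' p ζ (T ^ (2 * t + j)) ^ 2 / gaussSum' p ζ (T ^ (4 * j)) *
        (T ^ (4 * j)) (4 * lam) = _ := Eq.trans (Finset.sum_congr rfl fun j _ ↦ by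
      rw [hg, hg, hg, pow_add, hT2, mul_comm 4 j, pow_mul]) hsum
    rw [hsum', hT3, hT2]
    field_simp
    ring
  · intro i hi j hj h
    simp only [Finset.coe_range, Set.mem_Iio] at hi hj
    exact pow_injOn_Iio_orderOf hi hj h
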